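/- Let μ be a commutator matrix over ℤ_{2n} in Darboux normal form, with block entries λ_1, …, λ_r (so μ(2t−1, 2t) = λ_t = −μ(2t, 2t−1) and all other entries are 0). Then there exists a contextual word for μ if and only if there exist two distinct indices t ≠ t' such that λ_t and λ_{t'} are both nonzero and both odd relative to n. -/

import Mathlib

/-- `Σ𝒮(s)`: the sum over inversions of the word `s`. -/
def invSum (n d : ℕ) (μ : Fin n → Fin n → ZMod d) : List (Fin n) → ZMod d
  | [] => 0
  | x :: s => (s.map (fun y => if y < x then μ x y else 0)).sum + invSum n d μ s

/-- `Σ𝒮(s,t)`: the sum over inversions between `s` and `t`. -/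
def invSum2 (n d : ℕ) (μ : Fin n → Fin n → ZMod d) (s t : List (Fin n)) : ZMod d :=
  (s.map (fun x => (t.map (fun y => if y < x then μ x y else 0)).sum)).sum

/-- The formal commutator `⟦s,t⟧ := Σ𝒮(s,t) − Σ𝒮(t,s)`. -/
def fcomm (n d : ℕ) (μ : Fin n → Fin n → ZMod d) (s t : List (Fin n)) : ZMod d :=
  invSum2 n d μ s t - invSum2 n d μ t s

/-- Bracketings: binary trees with leaves labelled by generators. -/
inductive Brack (n : ℕ) : Type where
  | leaf : Fin n → Brack n
  | node : Brack n → Brack n → Brack n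

/-- `∂(β)`: the word of leaf labels of a bracketing. -/
def Brack.word {n : ℕ} : Brack n → List (Fin n)
  | .leaf x => [x]
  | .node b₁ b₂ => b₁.word ++ b₂.word

/-- A bracketing witnesses commuting products if `⟦∂(β₁), ∂(β₂)⟧ = 0` at every internal node. -/
def Brack.Ok (n d : ℕ) (μ : Fin n → Fin n → ZMod d) : Brack n → Prop
  | .leaf _ => True
  | .node b₁ b₂ =>
      fcomm n d μ b₁.word b₂.word = 0 ∧ Brack.Ok n d μ b₁ ∧ Brack.Ok n d μ b₂

/-- `w` is formed out of commuting products. -/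
def Commuting (n d : ℕ) (μ : Fin n → Fin n → ZMod d) (w : List (Fin n)) : Prop :=
  ∃ β : Brack n, Brack.Ok n d μ β ∧ β.word = w

/-- A contextual word for μ. -/
def ContextualWord (n d : ℕ) (μ : Fin n → Fin n → ZMod d) (w : List (Fin n)) : Prop :=
  w ≠ [] ∧ (∀ x : Fin n, d ∣ w.count x) ∧ Commuting n d μ w ∧ invSum n d μ w ≠ 0

/-- The Darboux normal form matrix with block entries `lam t` in rows/columns `2t, 2t+1`
(0-indexed). -/
def darboux (r n : ℕ) (lam : Fin r → ZMod (2 * n)) :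
    Fin (2 * r) → Fin (2 * r) → ZMod (2 * n) :=
  fun i j =>
    if i.val % 2 = 0 ∧ j.val = i.val + 1 then lam ⟨i.val / 2, by have := i.isLt; omega⟩
    else if j.val % 2 = 0 ∧ i.val = j.val + 1 then - lam ⟨j.val / 2, by have := j.isLt; omega⟩
    else 0

/-- `lam` (represented by its canonical representative in `{0, …, 2n−1}`) is
odd relative to `n`: ν₂(lam) ≤ ν₂(n). -/
def OddRelTo (n : ℕ) (lam : ZMod (2 * n)) : Prop :=
  (lam.val).factorization 2 ≤ n.factorization 2

section Words

variable {N d : ℕ} {μ : Fin N → Fin N → ZMod d}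

lemma invSum2_append_left (s s' t : List (Fin N)) :
    invSum2 N d μ (s ++ s') t = invSum2 N d μ s t + invSum2 N d μ s' t := by
  simp [invSum2]

lemma invSum2_append_right (s t t' : List (Fin N)) :
    invSum2 N d μ s (t ++ t') = invSum2 N d μ s t + invSum2 N d μ s t' := by
  simp [invSum2, List.sum_map_add]

lemma invSum_append (s t : List (Fin N)) :
    invSum N d μ (s ++ t) = invSum N d μ s + invSum N d μ t + invSum2 N d μ s t := by
  induction s with
  | nil => simp [invSum, invSum2]
  | cons x s ih =>
    simp only [List.cons_append, invSum, ih, List.map_append, List.sum_append]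
    simp only [invSum2, List.map_cons, List.sum_cons]
    ring

lemma invSum2_perm_left {s s' : List (Fin N)} (h : s.Perm s') (t : List (Fin N)) :
    invSum2 N d μ s t = invSum2 N d μ s' t :=
  (h.map _).sum_eq

lemma invSum2_perm_right (s : List (Fin N)) {t t' : List (Fin N)} (h : t.Perm t') :
    invSum2 N d μ s t = invSum2 N d μ s t' := by
  unfold invSum2
  congr 2
  funext x
  exact (h.map _).sum_eq

lemma invSum2_replicate (k l : ℕ) (i j : Fin N) :
    invSum2 N d μ (List.replicate k i) (List.replicate l j) =
      k * l * (if j < i then μ i j else 0) := by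
  simp [invSum2, mul_assoc]

lemma invSum_replicate (k : ℕ) (i : Fin N) : invSum N d μ (List.replicate k i) = 0 := by
  induction k with
  | zero => rfl
  | succ k ih => simp [List.replicate_succ, invSum, ih]

lemma fcomm_append_left (s s' t : List (Fin N)) :
    fcomm N d μ (s ++ s') t = fcomm N d μ s t + fcomm N d μ s' t := by
  simp only [fcomm, invSum2_append_left, invSum2_append_right]; ring

lemma fcomm_append_right (s t t' : List (Fin N)) :
    fcomm N d μ s (t ++ t') = fcomm N d μ s t + fcomm N d μ s t' := by
  simp only [fcomm, invSum2_append_left, invSum2_append_right]; ring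

lemma fcomm_perm {s t : List (Fin N)} (h : s.Perm t) : fcomm N d μ s t = 0 := by
  rw [fcomm, invSum2_perm_left h, invSum2_perm_right t h, sub_self]

lemma Commuting.append {s t : List (Fin N)} (hs : Commuting N d μ s) (ht : Commuting N d μ t)
    (h : fcomm N d μ s t = 0) : Commuting N d μ (s ++ t) := by
  obtain ⟨β, hβ, rfl⟩ := hs
  obtain ⟨γ, hγ, rfl⟩ := ht
  exact ⟨.node β γ, ⟨h, hβ, hγ⟩, rfl⟩

lemma fcomm_flatten_replicate {s t : List (Fin N)} (h : fcomm N d μ s t = 0) (k : ℕ) :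
    fcomm N d μ s (List.replicate k t).flatten = 0 := by
  induction k with
  | zero => simp [fcomm, invSum2]
  | succ k ih => rw [List.replicate_succ, List.flatten_cons, fcomm_append_right, h, ih, add_zero]

/-- A commuting word may be prepended to any power of a commuting word it commutes with. -/
lemma Commuting.append_power {s t : List (Fin N)} (hs : Commuting N d μ s)
    (ht : Commuting N d μ t) (h : fcomm N d μ s t = 0) (k : ℕ) :
    Commuting N d μ (s ++ (List.replicate k t).flatten) := by
  induction k generalizing s with
  | zero => simpa using hs
  | succ k ih =>
    rw [List.replicate_succ, List.flatten_cons]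
    exact hs.append (ih ht (fcomm_perm (.refl _))) (fcomm_flatten_replicate h (k + 1))

lemma Commuting.replicate {k : ℕ} (hk : k ≠ 0) (i : Fin N) :
    Commuting N d μ (List.replicate k i) := by
  obtain ⟨k, rfl⟩ := Nat.exists_eq_succ_of_ne_zero hk
  have hi : Commuting N d μ [i] := ⟨.leaf i, trivial, rfl⟩
  have := hi.append_power hi (fcomm_perm (.refl _)) k
  simpa [List.replicate_succ] using this

lemma Brack.word_ne_nil (β : Brack N) : β.word ≠ [] := by
  induction β with
  | leaf x => simp [Brack.word]
  | node b c hb hc => simp [Brack.word, hb]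

lemma two_mul_invSum_of_ok (β : Brack N) (h : β.Ok N d μ) :
    2 * invSum N d μ β.word = invSum2 N d μ β.word β.word := by
  induction β with
  | leaf x => simp [Brack.word, invSum, invSum2]
  | node b c hb hc =>
    obtain ⟨h, h₁, h₂⟩ := h
    have hb := hb h₁
    have hc := hc h₂
    have h : invSum2 N d μ b.word c.word = invSum2 N d μ c.word b.word := sub_eq_zero.mp h
    simp only [Brack.word, invSum_append, invSum2_append_left, invSum2_append_right]
    linear_combination hb + hc + h

lemma invSum2_eq_zero_of_dvd_count {s : List (Fin N)} (hs : ∀ x, d ∣ s.count x)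
    (t : List (Fin N)) : invSum2 N d μ s t = 0 := by
  rw [invSum2, Finset.sum_list_map_count]
  refine Finset.sum_eq_zero fun x _ => ?_
  rw [nsmul_eq_mul, (ZMod.natCast_eq_zero_iff _ _).mpr (hs x), zero_mul]

/-- Two permuted commuting words with different inversion sums give a contextual word. -/
lemma exists_contextualWord_of_perm (hd : d ≠ 0) {s t : List (Fin N)} (hp : s.Perm t)
    (hs : Commuting N d μ s) (ht : Commuting N d μ t)
    (hne : invSum N d μ s ≠ invSum N d μ t) : ∃ w, ContextualWord N d μ w := by
  obtain ⟨k, rfl⟩ := Nat.exists_eq_succ_of_ne_zero hd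
  have key : ∀ u : List (Fin N), u.Perm t → Commuting N (k + 1) μ u →
      invSum N (k + 1) μ (u ++ (List.replicate k t).flatten) ≠ 0 →
      ∃ w, ContextualWord N (k + 1) μ w := by
    intro u hu hc hf
    refine ⟨_, ?_, fun x => ?_, hc.append_power ht (fcomm_perm hu) k, hf⟩
    · obtain ⟨β, -, rfl⟩ := hc
      simp [β.word_ne_nil]
    · refine ⟨t.count x, ?_⟩
      simp only [List.count_append, hu.count_eq, List.count_flatten, List.map_replicate,
        List.sum_replicate, smul_eq_mul]
      ring
  by_cases h : invSum N (k + 1) μ (s ++ (List.replicate k t).flatten) = 0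
  · refine key t (.refl _) ht fun h' => hne ?_
    rw [invSum_append] at h h'
    rw [invSum2_perm_left hp] at h
    linear_combination h - h'
  · exact key s hp hs h

variable {D : ℕ} (φ : ZMod d →+* ZMod D)

lemma invSum2_map (s t : List (Fin N)) :
    invSum2 N D (fun i j => φ (μ i j)) s t = φ (invSum2 N d μ s t) := by
  simp only [invSum2, map_list_sum, List.map_map, Function.comp_def]
  congr! 6
  split_ifs <;> simp

lemma invSum_map (s : List (Fin N)) :
    invSum N D (fun i j => φ (μ i j)) s = φ (invSum N d μ s) := by
  induction s with
  | nil => simp [invSum]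
  | cons x s ih =>
    simp only [invSum, ih, map_add, map_list_sum, List.map_map, Function.comp_def]
    congr! 4
    split_ifs <;> simp

lemma Brack.Ok.map {β : Brack N} (h : β.Ok N d μ) : β.Ok N D (fun i j => φ (μ i j)) := by
  induction β with
  | leaf x => trivial
  | node b c hb hc =>
    refine ⟨?_, hb h.2.1, hc h.2.2⟩
    rw [fcomm, invSum2_map, invSum2_map, ← map_sub]
    exact (congrArg φ h.1).trans (map_zero φ)

end Words

lemma two_pow_dvd_of_modEq_of_dvd_mul {k x y : ℕ} (h : x ≡ y [MOD 2 ^ k])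
    (hxy : 2 ^ k * 2 ^ k ∣ x * y) : 2 ^ k ∣ x := by
  suffices ∀ j ≤ k, 2 ^ j ∣ x from this k le_rfl
  intro j
  induction j with
  | zero => simp
  | succ j ih =>
    intro hj
    have hx := ih (by omega)
    have hy : 2 ^ j ∣ y := ((h.of_dvd (pow_dvd_pow 2 (by omega))).dvd_iff dvd_rfl).mp hx
    have hmul : 2 ^ (j + j + 1) ∣ x * y :=
      (pow_dvd_pow 2 (by omega : j + j + 1 ≤ k + k)).trans (pow_add 2 k k ▸ hxy)
    rcases succ_dvd_or_succ_dvd_of_succ_sum_dvd_mul Nat.prime_two.prime hx hy hmul with h' | h'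
    · exact h'
    · exact ((h.of_dvd (pow_dvd_pow 2 hj)).dvd_iff dvd_rfl).mpr h'

lemma ZMod.two_pow_mul_eq_zero {k : ℕ} (κ : ZMod (2 ^ k)) (p q p' q' : ℕ)
    (h : κ * p * q = 0) (h' : κ * p' * q' = 0) (hc : κ * p * q' = κ * p' * q) :
    κ * p * q' = 0 := by
  obtain ⟨c, rfl⟩ := ZMod.natCast_zmod_surjective κ
  norm_cast at *
  rw [ZMod.natCast_eq_zero_iff] at *
  rw [ZMod.natCast_eq_natCast_iff] at hc
  refine two_pow_dvd_of_modEq_of_dvd_mul hc ?_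
  have := mul_dvd_mul h h'
  rwa [show c * p * q * (c * p' * q') = c * p * q' * (c * p' * q) by ring] at this

/-- Over `ℤ/2^k`, a form supported on one pair of generators admits no contextual words. -/
lemma invSum_eq_zero_of_single_block {N k : ℕ} {μ : Fin N → Fin N → ZMod (2 ^ k)} (a b : Fin N)
    (hab : a ≠ b) (κ : ZMod (2 ^ k))
    (hμ : ∀ i j, (if j < i then μ i j else 0) = if i = b ∧ j = a then κ else 0)
    (β : Brack N) (h : β.Ok N (2 ^ k) μ) :
    κ * β.word.count b * β.word.count a = 0 ∧ invSum N (2 ^ k) μ β.word = 0 := by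
  have hind : ∀ (c : Fin N) (e : ZMod (2 ^ k)) (s : List (Fin N)),
      (s.map fun x => if x = c then e else 0).sum = s.count c * e := by
    intro c e s
    induction s with
    | nil => simp
    | cons x s ih =>
      by_cases hx : x = c
      · subst hx; simp [ih]; ring
      · simp [ih, hx]
  have hS : ∀ s t, invSum2 N (2 ^ k) μ s t = κ * s.count b * t.count a := by
    intro s t
    have : ∀ x, (t.map fun y => if x = b ∧ y = a then κ else 0).sum =
        if x = b then t.count a * κ else 0 := by
      intro x
      by_cases hx : x = b
      · simp [hx, hind]
      · simp [hx]
    simp only [invSum2, hμ, this, hind]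
    ring
  induction β with
  | leaf x =>
    refine ⟨?_, by simp [Brack.word, invSum]⟩
    by_cases hx : x = a
    · subst hx; simp [Brack.word, hab]
    · simp [Brack.word, hx]
  | node s t hs ht =>
    obtain ⟨h, h₁, h₂⟩ := h
    obtain ⟨hs, fs⟩ := hs h₁
    obtain ⟨ht, ft⟩ := ht h₂
    rw [fcomm, hS, hS, sub_eq_zero] at h
    have h0 := ZMod.two_pow_mul_eq_zero κ _ _ _ _ hs ht h
    refine ⟨?_, ?_⟩
    · simp only [Brack.word, List.count_append, Nat.cast_add]
      linear_combination hs + ht + h0 + (h0 - h)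
    · rw [Brack.word, invSum_append, fs, ft, hS, h0]; simp

lemma two_mul_dvd_of_two_pow_dvd {n v : ℕ} (hn : n ≠ 0) (h : n ∣ v)
    (h2 : 2 ^ (n.factorization 2 + 1) ∣ v) : 2 * n ∣ v := by
  have hcop : Nat.Coprime (2 ^ (n.factorization 2 + 1)) (n / 2 ^ n.factorization 2) :=
    (Nat.coprime_ordCompl Nat.prime_two hn).pow_left _
  have := hcop.mul_dvd_of_dvd_of_dvd h2 ((Nat.ordCompl_dvd n 2).trans h)
  rwa [pow_succ', mul_assoc, Nat.ordProj_mul_ordCompl_eq_self] at this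

lemma OddRelTo.exists_mul_eq {n : ℕ} (hn : n ≠ 0) {l : ZMod (2 * n)} (h0 : l ≠ 0)
    (h : OddRelTo n l) : ∃ x : ℕ, l * x = n := by
  have : NeZero (2 * n) := ⟨by omega⟩
  have hv : l.val ≠ 0 := by rwa [Ne, ZMod.val_eq_zero]
  have hg : Nat.gcd l.val (2 * n) ∣ n := by
    obtain ⟨c, hc⟩ := Nat.gcd_dvd_right l.val (2 * n)
    rcases Nat.even_or_odd c with ⟨e, he⟩ | hodd
    · exact ⟨e, by subst he; linarith⟩
    · exfalso
      have h1 : 2 ^ (n.factorization 2 + 1) ∣ Nat.gcd l.val (2 * n) * c := by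
        rw [← hc, pow_succ']
        exact mul_dvd_mul_left 2 (Nat.ordProj_dvd n 2)
      have h2 := (Nat.Coprime.dvd_of_dvd_mul_right
        ((Nat.coprime_two_left.mpr hodd).pow_left _) h1).trans (Nat.gcd_dvd_left _ _)
      have := (Nat.prime_two.pow_dvd_iff_le_factorization hv).mp h2
      unfold OddRelTo at h
      omega
  obtain ⟨c, hc⟩ := hg
  have hb := congrArg (Int.cast : ℤ → ZMod (2 * n)) (Nat.gcd_eq_gcd_ab l.val (2 * n))
  have hz : ((2 * n : ℕ) : ZMod (2 * n)) = 0 := ZMod.natCast_self _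
  simp only [Int.cast_add, Int.cast_mul, Int.cast_natCast, hz, zero_mul, add_zero,
    ZMod.natCast_zmod_val] at hb
  obtain ⟨x, hx⟩ := ZMod.natCast_zmod_surjective
    ((Nat.gcdA l.val (2 * n) : ZMod (2 * n)) * (c : ZMod (2 * n)))
  refine ⟨x, ?_⟩
  have hc' := congrArg (Nat.cast : ℕ → ZMod (2 * n)) hc
  push_cast at hc'
  rw [hx, hc', hb]
  ring

section Darboux

variable {r n : ℕ}

lemma darboux_below (lam : Fin r → ZMod (2 * n)) (i j : Fin (2 * r)) :
    (if j < i then darboux r n lam i j else 0) =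
      if j.val % 2 = 0 ∧ i.val = j.val + 1 then - lam ⟨j.val / 2, by omega⟩ else 0 := by
  simp only [darboux, Fin.lt_def]
  split_ifs <;> first | rfl | omega

/-- The first generator of the block `t`. -/
def blockFst (t : Fin r) : Fin (2 * r) := ⟨2 * t, by omega⟩

/-- The second generator of the block `t`. -/
def blockSnd (t : Fin r) : Fin (2 * r) := ⟨2 * t + 1, by omega⟩

lemma exists_contextualWord_darboux (hn : n ≠ 0) (lam : Fin r → ZMod (2 * n)) {t u : Fin r}
    (htu : t ≠ u) (ht : lam t ≠ 0) (hu : lam u ≠ 0) (ot : OddRelTo n (lam t))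
    (ou : OddRelTo n (lam u)) :
    ∃ w, ContextualWord (2 * r) (2 * n) (darboux r n lam) w := by
  obtain ⟨x, hx⟩ := ot.exists_mul_eq hn ht
  obtain ⟨y, hy⟩ := ou.exists_mul_eq hn hu
  have hn0 : (n : ZMod (2 * n)) ≠ 0 := by
    rw [Ne, ZMod.natCast_eq_zero_iff]
    exact fun h => by have := Nat.le_of_dvd (by omega) h; omega
  have hx0 : x ≠ 0 := by rintro rfl; simp at hx; exact hn0 hx.symm
  have hy0 : y ≠ 0 := by rintro rfl; simp at hy; exact hn0 hy.symm
  have h2n : (n : ZMod (2 * n)) + n = 0 := by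
    have := ZMod.natCast_self (2 * n)
    push_cast at this
    linear_combination this
  have htu' : t.val ≠ u.val := fun h => htu (Fin.ext h)
  have hm : ∀ (k l : ℕ) (i j : Fin (2 * r)), invSum2 (2 * r) (2 * n) (darboux r n lam)
      (List.replicate k i) (List.replicate l j) =
      k * l * if j.val % 2 = 0 ∧ i.val = j.val + 1 then - lam ⟨j.val / 2, by omega⟩ else 0 := by
    intro k l i j
    rw [invSum2_replicate, darboux_below]
  have hba : ∀ (s : Fin r) (k l : ℕ), invSum2 (2 * r) (2 * n) (darboux r n lam)
      (List.replicate k (blockSnd s)) (List.replicate l (blockFst s)) = - (k * l * lam s) := by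
    intro s k l
    rw [hm]; simp [blockFst, blockSnd]
  have hab : ∀ (s s' : Fin r) (k l : ℕ), invSum2 (2 * r) (2 * n) (darboux r n lam)
      (List.replicate k (blockFst s)) (List.replicate l (blockSnd s')) = 0 := by
    intro s s' k l
    rw [hm, if_neg, mul_zero]
    simp only [blockFst, blockSnd]; omega
  have haa : ∀ (s s' : Fin r) (k l : ℕ), invSum2 (2 * r) (2 * n) (darboux r n lam)
      (List.replicate k (blockFst s)) (List.replicate l (blockFst s')) = 0 := by
    intro s s' k l
    rw [hm, if_neg, mul_zero]
    simp only [blockFst]; omega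
  have hbb : ∀ (s s' : Fin r) (k l : ℕ), invSum2 (2 * r) (2 * n) (darboux r n lam)
      (List.replicate k (blockSnd s)) (List.replicate l (blockSnd s')) = 0 := by
    intro s s' k l
    rw [hm, if_neg, mul_zero]
    simp only [blockSnd]; omega
  have hba' : ∀ (s s' : Fin r) (k l : ℕ), s.val ≠ s'.val →
      invSum2 (2 * r) (2 * n) (darboux r n lam)
      (List.replicate k (blockSnd s)) (List.replicate l (blockFst s')) = 0 := by
    intro s s' k l hs
    rw [hm, if_neg, mul_zero]
    simp only [blockFst, blockSnd]; omega
  refine exists_contextualWord_of_perm (by omega)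
    (s := (List.replicate x (blockFst t) ++ List.replicate y (blockFst u)) ++
      (List.replicate 1 (blockSnd t) ++ List.replicate 1 (blockSnd u)))
    (t := (List.replicate x (blockFst t) ++ List.replicate 1 (blockSnd u)) ++
      (List.replicate 1 (blockSnd t) ++ List.replicate y (blockFst u))) ?_ ?_ ?_ ?_
  · rw [List.perm_iff_count]
    intro z
    simp only [List.count_append]
    omega
  · refine .append (.append (.replicate hx0 _) (.replicate hy0 _) ?_)
      (.append (.replicate one_ne_zero _) (.replicate one_ne_zero _) ?_) ?_
    · simp only [fcomm, haa, sub_zero]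
    · simp only [fcomm, hbb, sub_zero]
    · simp only [fcomm_append_left, fcomm_append_right]
      simp only [fcomm, hab, hba, hba' _ _ _ _ htu', hba' _ _ _ _ htu'.symm]
      push_cast
      linear_combination hx + hy + h2n
  · refine .append (.append (.replicate hx0 _) (.replicate one_ne_zero _) ?_)
      (.append (.replicate one_ne_zero _) (.replicate hy0 _) ?_) ?_
    · simp only [fcomm, hab, hba' _ _ _ _ htu'.symm, sub_zero]
    · simp only [fcomm, hab, hba' _ _ _ _ htu', sub_zero]
    · simp only [fcomm_append_left, fcomm_append_right]
      simp only [fcomm, haa, hbb, hab, hba]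
      push_cast
      linear_combination hx - hy
  · simp only [invSum_append, invSum_replicate, invSum2_append_left, invSum2_append_right,
      haa, hbb, hab, hba, hba' _ _ _ _ htu']
    intro h
    push_cast at h
    apply hn0
    linear_combination h - hy

lemma exists_unique_odd_of_not_two (hr : 1 ≤ r) (lam : Fin r → ZMod (2 * n))
    (h : ¬ ∃ t t' : Fin r, t ≠ t' ∧ lam t ≠ 0 ∧ lam t' ≠ 0 ∧
      OddRelTo n (lam t) ∧ OddRelTo n (lam t')) :
    ∃ t, ∀ u ≠ t, lam u ≠ 0 → ¬ OddRelTo n (lam u) := by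
  by_cases ht : ∃ t, lam t ≠ 0 ∧ OddRelTo n (lam t)
  · obtain ⟨t, h0, ho⟩ := ht
    exact ⟨t, fun u hu hu0 huo => h ⟨t, u, hu.symm, h0, hu0, ho, huo⟩⟩
  · exact ⟨⟨0, hr⟩, fun u _ hu0 huo => ht ⟨u, hu0, huo⟩⟩

lemma not_contextualWord_darboux (hn : n ≠ 0) (lam : Fin r → ZMod (2 * n)) (t : Fin r)
    (ht : ∀ u ≠ t, lam u ≠ 0 → ¬ OddRelTo n (lam u)) (w : List (Fin (2 * r))) :
    ¬ ContextualWord (2 * r) (2 * n) (darboux r n lam) w := by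
  rintro ⟨-, hcount, ⟨β, hβ, rfl⟩, hne⟩
  have : NeZero (2 * n) := ⟨by omega⟩
  have hdvd : 2 ^ (n.factorization 2 + 1) ∣ 2 * n := by
    rw [pow_succ']
    exact mul_dvd_mul_left 2 (Nat.ordProj_dvd n 2)
  let φ := ZMod.castHom hdvd (ZMod (2 ^ (n.factorization 2 + 1)))
  have hφ : ∀ z : ZMod (2 * n), φ z = (z.val : ZMod (2 ^ (n.factorization 2 + 1))) := by
    intro z
    conv_lhs => rw [← ZMod.natCast_zmod_val z]
    exact map_natCast φ _
  have hzero : ∀ u ≠ t, φ (lam u) = 0 := by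
    intro u hu
    by_cases h0 : lam u = 0
    · rw [h0, map_zero]
    · have hodd := ht u hu h0
      unfold OddRelTo at hodd
      rw [hφ, ZMod.natCast_eq_zero_iff]
      exact (pow_dvd_pow 2 (by omega)).trans (Nat.ordProj_dvd _ 2)
  have hmod : φ (invSum (2 * r) (2 * n) (darboux r n lam) β.word) = 0 := by
    rw [← invSum_map]
    refine (invSum_eq_zero_of_single_block (blockFst t) (blockSnd t) ?_ (- φ (lam t)) ?_ β
      (hβ.map φ)).2
    · simp [blockFst, blockSnd, Fin.ext_iff]
    · intro i j
      have hb := congrArg φ (darboux_below lam i j)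
      rw [apply_ite φ, map_zero] at hb
      rw [hb, apply_ite φ, map_zero, map_neg]
      by_cases hij : j.val % 2 = 0 ∧ i.val = j.val + 1
      · rw [if_pos hij]
        by_cases hjt : (⟨j.val / 2, by omega⟩ : Fin r) = t
        · rw [hjt, if_pos]
          subst hjt
          constructor <;> ext <;> simp only [blockFst, blockSnd] <;> omega
        · rw [hzero _ hjt, neg_zero, if_neg]
          rintro ⟨-, rfl⟩
          exact hjt (by ext; simp [blockFst])
      · rw [if_neg hij, if_neg]
        rintro ⟨rfl, rfl⟩
        exact hij (by simp [blockFst, blockSnd])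
  have htwo := two_mul_invSum_of_ok β hβ
  rw [invSum2_eq_zero_of_dvd_count hcount] at htwo
  apply hne
  generalize invSum (2 * r) (2 * n) (darboux r n lam) β.word = z at *
  rw [hφ, ZMod.natCast_eq_zero_iff] at hmod
  rw [← ZMod.natCast_zmod_val z] at htwo ⊢
  have htwo' : ((2 * z.val : ℕ) : ZMod (2 * n)) = 0 := by push_cast; simpa using htwo
  rw [ZMod.natCast_eq_zero_iff] at htwo' ⊢
  exact two_mul_dvd_of_two_pow_dvd hn (Nat.dvd_of_mul_dvd_mul_left two_pos htwo') hmod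

end Darboux

theorem stmt16 (n r : ℕ) (hn : 1 ≤ n) (hr : 1 ≤ r) (lam : Fin r → ZMod (2 * n)) :
    (∃ w : List (Fin (2 * r)), ContextualWord (2 * r) (2 * n) (darboux r n lam) w) ↔
    ∃ t t' : Fin r, t ≠ t' ∧ lam t ≠ 0 ∧ lam t' ≠ 0 ∧
      OddRelTo n (lam t) ∧ OddRelTo n (lam t') := by
  constructor
  · rintro ⟨w, hw⟩
    by_contra h
    obtain ⟨t, ht⟩ := exists_unique_odd_of_not_two hr lam h
    exact not_contextualWord_darboux (by omega) lam t ht w hw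
  · rintro ⟨t, u, htu, ht, hu, ot, ou⟩
    exact exists_contextualWord_darboux (by omega) lam htu ht hu ot ou
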